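/- Let h(t) = t e^{-t/6}, let a ∈ (0,1], set h_a(t) = h(t+a), and let G_a(x,t) = (t+a)^{-n/2} e^{-|x|^2/(4(t+a))} be the translated Gauss kernel. Then for every t ∈ (0,4]: (1/e)(t+a) ≤ h_a(t) ≤ t+a, 1/(6e) ≤ ḣ_a(t) ≤ 1, and the matrix 𝒟_{G_a} = (d/dt log(h_a/ḣ_a)) · I + 2 D^2_x(log G_a) satisfies 𝒟_{G_a} ≥ (1/6) I in the sense of quadratic forms, where I is the n×n identity matrix and D^2_x denotes the Hessian in the space variables. -/

import Mathlib

open MeasureTheory Real Set Metric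

/-- The function `h(t) = t e^{-t/6}`. -/
noncomputable def h12 (t : ℝ) : ℝ := t * Real.exp (-t / 6)

/-- The translated Gauss kernel `G_a(x,t) = (t+a)^{-n/2} e^{-|x|²/(4(t+a))}`. -/
noncomputable def gaussKer (n : ℕ) (a : ℝ) (x : EuclideanSpace ℝ (Fin n)) (t : ℝ) : ℝ :=
  (t + a) ^ (-(n : ℝ) / 2) * Real.exp (-‖x‖ ^ 2 / (4 * (t + a)))

theorem hasDerivAt_h12_add (a s : ℝ) :
    HasDerivAt (fun s => h12 (s + a)) ((1 - (s + a) / 6) * Real.exp (-(s + a) / 6)) s := by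
  have h₁ : HasDerivAt (fun s : ℝ => s + a) 1 s := (hasDerivAt_id s).add_const a
  have h₂ : HasDerivAt (fun s : ℝ => Real.exp (-(s + a) / 6))
      (Real.exp (-(s + a) / 6) * (-1 / 6)) s := (h₁.neg.div_const 6).exp
  refine (h₁.mul h₂).congr_deriv ?_
  ring

theorem deriv_h12_add (a s : ℝ) :
    deriv (fun s => h12 (s + a)) s = (1 - (s + a) / 6) * Real.exp (-(s + a) / 6) :=
  (hasDerivAt_h12_add a s).deriv

theorem deriv_log_h12_div_deriv {a t : ℝ} (h₀ : 0 < t + a) (h₆ : t + a < 6) :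
    deriv (fun s => Real.log (h12 (s + a) / deriv (fun s => h12 (s + a)) s)) t =
      1 / (t + a) + 1 / (6 - (t + a)) := by
  have hquot : (fun s => Real.log (h12 (s + a) / deriv (fun s => h12 (s + a)) s)) =
      fun s => Real.log ((s + a) / (1 - (s + a) / 6)) := by
    funext s
    rw [deriv_h12_add, h12, mul_div_mul_right _ _ (Real.exp_pos _).ne']
  have hne : 1 - (t + a) / 6 ≠ 0 := by linarith
  have hne' : 6 - (t + a) ≠ 0 := by linarith
  have h₁ : HasDerivAt (fun s : ℝ => s + a) 1 t := (hasDerivAt_id t).add_const a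
  have h₂ := (h₁.div ((h₁.div_const 6).const_sub 1) hne).log (div_ne_zero h₀.ne' hne)
  rw [hquot]
  refine (h₂.congr_deriv ?_).deriv
  simp only [Pi.div_apply]
  field_simp
  ring

theorem log_gaussKer {n : ℕ} {a t : ℝ} (h₀ : 0 < t + a) (x : EuclideanSpace ℝ (Fin n)) :
    Real.log (gaussKer n a x t) =
      Real.log ((t + a) ^ (-(n : ℝ) / 2)) + -(1 / (4 * (t + a))) * ‖x‖ ^ 2 := by
  rw [gaussKer, Real.log_mul (Real.rpow_pos_of_pos h₀ _).ne' (Real.exp_pos _).ne', Real.log_exp]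
  ring

theorem fderiv_log_gaussKer {n : ℕ} {a t : ℝ} (h₀ : 0 < t + a)
    (y v : EuclideanSpace ℝ (Fin n)) :
    fderiv ℝ (fun z => Real.log (gaussKer n a z t)) y v =
      -(1 / (2 * (t + a))) * inner ℝ v y := by
  have h := (((hasStrictFDerivAt_norm_sq y).hasFDerivAt.const_mul
    (-(1 / (4 * (t + a))))).const_add (Real.log ((t + a) ^ (-(n : ℝ) / 2))))
  simp only [log_gaussKer h₀]
  rw [h.fderiv]
  simp only [smul_apply, innerSL_apply_apply, nsmul_eq_mul, smul_eq_mul,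
    Nat.cast_ofNat, real_inner_comm v y]
  field_simp
  ring

theorem hessian_log_gaussKer {n : ℕ} {a t : ℝ} (h₀ : 0 < t + a)
    (x v : EuclideanSpace ℝ (Fin n)) :
    fderiv ℝ (fun y => fderiv ℝ (fun z => Real.log (gaussKer n a z t)) y v) x v =
      -(1 / (2 * (t + a))) * ‖v‖ ^ 2 := by
  have h := ((innerSL ℝ v).hasFDerivAt (x := x)).const_mul (-(1 / (2 * (t + a))))
  simp only [innerSL_apply_apply] at h
  simp only [fderiv_log_gaussKer h₀]
  rw [h.fderiv]
  simp

/-- with `h(t) = t e^{-t/6}`, `a ∈ (0,1]`, `h_a(t) = h(t+a)` and the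
translated Gauss kernel `G_a`, for every `t ∈ (0,4]` one has
`(1/e)(t+a) ≤ h_a(t) ≤ t+a`, `1/(6e) ≤ ḣ_a(t) ≤ 1`, and the quadratic form
`𝒟_{G_a} = (d/dt log(h_a/ḣ_a)) I + 2 D²ₓ(log G_a)` satisfies `𝒟_{G_a} ≥ (1/6) I`. -/
theorem stmt_12 (n : ℕ) (a : ℝ) (ha : a ∈ Ioc (0 : ℝ) 1)
    (hA : ℝ → ℝ) (hhA : hA = fun s => h12 (s + a)) :
    ∀ t ∈ Ioc (0 : ℝ) 4,
      ((1 / Real.exp 1) * (t + a) ≤ hA t ∧ hA t ≤ t + a) ∧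
      (1 / (6 * Real.exp 1) ≤ deriv hA t ∧ deriv hA t ≤ 1) ∧
      ∀ (x v : EuclideanSpace ℝ (Fin n)),
        (1 / 6) * ‖v‖ ^ 2 ≤
          deriv (fun s => Real.log (hA s / deriv hA s)) t * ‖v‖ ^ 2 +
            2 * fderiv ℝ
              (fun y => fderiv ℝ (fun z => Real.log (gaussKer n a z t)) y v) x v := by
  subst hhA
  rintro t ⟨ht, ht'⟩
  obtain ⟨ha, ha'⟩ := ha
  have h₀ : 0 < t + a := by linarith
  have h₆ : t + a < 6 := by linarith
  have hle : Real.exp (-(t + a) / 6) ≤ 1 := Real.exp_le_one_iff.2 (by linarith)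
  have hge : 1 / Real.exp 1 ≤ Real.exp (-(t + a) / 6) := by
    rw [one_div, ← Real.exp_neg]
    exact Real.exp_le_exp.2 (by linarith)
  refine ⟨⟨?_, ?_⟩, ⟨?_, ?_⟩, fun x v => ?_⟩
  · rw [mul_comm]
    exact mul_le_mul_of_nonneg_left hge h₀.le
  · exact mul_le_of_le_one_right h₀.le hle
  · rw [deriv_h12_add, ← one_div_mul_one_div]
    exact mul_le_mul (by linarith) hge (by positivity) (by linarith)
  · rw [deriv_h12_add]
    exact mul_le_one₀ (by linarith) (Real.exp_pos _).le hle
  · rw [deriv_log_h12_div_deriv h₀ h₆, hessian_log_gaussKer h₀]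
    have h : 1 / 6 ≤ 1 / (6 - (t + a)) := one_div_le_one_div_of_le (by linarith) (by linarith)
    calc 1 / 6 * ‖v‖ ^ 2 ≤ 1 / (6 - (t + a)) * ‖v‖ ^ 2 := by gcongr
      _ = _ := by field_simp; ring
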